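/- arXiv:2210.06017 — 3 statements merged into one kernel-verified Lean document; each statement's English description precedes it below -/
import Mathlib

section
/- Let z denote the image in N1 of the word cba. Then z is cancellable in N1: for all w, v ∈ N1, if z * w = z * v then w = v. Likewise, the image z of cba in N2 is cancellable in N2. -/
namespace Plactic

/-- The generator `a`. -/
def a : FreeMonoid (Fin 3) := FreeMonoid.of 0
/-- The generator `b`. -/
def b : FreeMonoid (Fin 3) := FreeMonoid.of 1
/-- The generator `c`. -/
def c : FreeMonoid (Fin 3) := FreeMonoid.of 2

/-- The eight Knuth relations on three generators. -/
inductive KnuthRel : FreeMonoid (Fin 3) → FreeMonoid (Fin 3) → Prop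
  | aba : KnuthRel (a * b * a) (b * a * a)
  | bab : KnuthRel (b * a * b) (b * b * a)
  | aca : KnuthRel (a * c * a) (c * a * a)
  | cac : KnuthRel (c * a * c) (c * c * a)
  | cbb : KnuthRel (c * b * b) (b * c * b)
  | cbc : KnuthRel (c * b * c) (c * c * b)
  | bac : KnuthRel (b * a * c) (b * c * a)
  | acb : KnuthRel (a * c * b) (c * a * b)

/-- The plactic congruence: the congruence generated by the Knuth relations. -/
def placticCon : Con (FreeMonoid (Fin 3)) := conGen KnuthRel

/-- The plactic monoid with three generators. -/
abbrev M := placticCon.Quotient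

/-- The natural projection from the free monoid onto the plactic monoid. -/
def mk : FreeMonoid (Fin 3) →* M := placticCon.mk'

/-- The congruence on `M` generated by the pair `(ac, ca)`. -/
def con1 : Con M := conGen (fun x y => x = mk (a * c) ∧ y = mk (c * a))

/-- `N1 = M/(ac = ca)`. -/
abbrev N1 := con1.Quotient

/-- The congruence on `M` generated by the pair `(bacb, cbab)`. -/
def con2 : Con M := conGen (fun x y => x = mk (b * a * c * b) ∧ y = mk (c * b * a * b))

/-- The grammic monoid `N2 = M/(bacb = cbab)`. -/
abbrev N2 := con2.Quotient



/-! ### Plactic triples in an arbitrary monoid -/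

/-- A triple of elements of a monoid satisfying the Knuth relations. -/
structure Pl {N : Type*} [Monoid N] (a b c : N) : Prop where
  aba : a * b * a = b * a * a
  bab : b * a * b = b * b * a
  aca : a * c * a = c * a * a
  cac : c * a * c = c * c * a
  cbb : c * b * b = b * c * b
  cbc : c * b * c = c * c * b
  bac : b * a * c = b * c * a
  acb : a * c * b = c * a * b

namespace Pl
variable {N : Type*} [Monoid N] {a b c : N}

theorem a_ba (h : Pl a b c) : Commute a (b * a) := by
  have := h.aba
  simpa [Commute, SemiconjBy, mul_assoc] using this

theorem b_ba (h : Pl a b c) : Commute b (b * a) := by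
  have := h.bab
  simpa [Commute, SemiconjBy, mul_assoc] using this.symm

theorem a_ca (h : Pl a b c) : Commute a (c * a) := by
  have := h.aca
  simpa [Commute, SemiconjBy, mul_assoc] using this

theorem c_ca (h : Pl a b c) : Commute c (c * a) := by
  have := h.cac
  simpa [Commute, SemiconjBy, mul_assoc] using this.symm

theorem b_cb (h : Pl a b c) : Commute b (c * b) := by
  have := h.cbb
  simpa [Commute, SemiconjBy, mul_assoc] using this.symm

theorem c_cb (h : Pl a b c) : Commute c (c * b) := by
  have := h.cbc
  simpa [Commute, SemiconjBy, mul_assoc] using this.symm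

theorem z_a (h : Pl a b c) : Commute (c * b * a) a := by
  show c * b * a * a = a * (c * b * a)
  calc c * b * a * a = c * (b * a * a) := by simp only [mul_assoc]
    _ = c * a * b * a := by rw [← h.aba]; simp only [mul_assoc]
    _ = a * (c * b * a) := by rw [← h.acb]; simp only [mul_assoc]

theorem z_b (h : Pl a b c) : Commute (c * b * a) b := by
  show c * b * a * b = b * (c * b * a)
  calc c * b * a * b = c * (b * a * b) := by simp only [mul_assoc]
    _ = c * b * b * a := by rw [h.bab]; simp only [mul_assoc]
    _ = b * (c * b * a) := by rw [h.cbb]; simp only [mul_assoc]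

theorem z_c (h : Pl a b c) : Commute (c * b * a) c := by
  show c * b * a * c = c * (c * b * a)
  calc c * b * a * c = c * (b * a * c) := by simp only [mul_assoc]
    _ = c * b * c * a := by rw [h.bac]; simp only [mul_assoc]
    _ = c * (c * b * a) := by rw [h.cbc]; simp only [mul_assoc]

theorem cb_ba (h : Pl a b c) : c * b * (b * a) = c * b * a * b := by
  rw [h.z_b.eq, ← mul_assoc, h.cbb]; simp only [mul_assoc]

theorem ca_ba (h : Pl a b c) : c * a * (b * a) = c * b * a * a := by
  rw [h.z_a.eq, ← mul_assoc, ← h.acb]; simp only [mul_assoc]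

theorem cb_ca (h : Pl a b c) : c * b * (c * a) = c * b * a * c := by
  rw [h.z_c.eq, ← mul_assoc, h.cbc]; simp only [mul_assoc]

/-- The power of `c` passes `b`. -/
theorem cpow_b (h : Pl a b c) (p : ℕ) : c ^ (p + 1) * b = c * b * c ^ p := by
  rw [pow_succ, mul_assoc, (h.c_cb.pow_left p).eq]

theorem cpow_a (h : Pl a b c) (p : ℕ) : c ^ (p + 1) * a = c * a * c ^ p := by
  rw [pow_succ, mul_assoc, (h.c_ca.pow_left p).eq]

theorem bpow_a (h : Pl a b c) (p : ℕ) : b ^ (p + 1) * a = b * a * b ^ p := by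
  rw [pow_succ, mul_assoc, (h.b_ba.pow_left p).eq]

theorem apow_cb (h : Pl a b c) (m : ℕ) : a ^ (m + 1) * (c * b) = c * a * a ^ m * b := by
  rw [pow_succ, mul_assoc, ← mul_assoc a, h.acb, ← mul_assoc, (h.a_ca.pow_left m).eq]

theorem b_cpow_a (h : Pl a b c) (p : ℕ) : b * c ^ p * a = b * a * c ^ p := by
  cases p with
  | zero => simp
  | succ p =>
    rw [mul_assoc, h.cpow_a, ← mul_assoc, ← mul_assoc, ← h.bac, mul_assoc, ← pow_succ']

theorem bpow_cpow_a (h : Pl a b c) (n p : ℕ) :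
    b ^ (n + 1) * c ^ p * a = b * a * b ^ n * c ^ p := by
  rw [pow_succ, mul_assoc, mul_assoc, ← mul_assoc b, h.b_cpow_a, ← h.bpow_a, pow_succ]
  simp only [mul_assoc]

/-! ### Tableau forms -/

/-- Product of columns. -/
def T (a b c : N) (i j k l m n p : ℕ) : N :=
  (c * b * a) ^ i * ((b * a) ^ j * ((c * a) ^ k * ((c * b) ^ l * (a ^ m * (b ^ n * c ^ p)))))

theorem z_T (i j k l m n p : ℕ) :
    (c * b * a) * T a b c i j k l m n p = T a b c (i + 1) j k l m n p := by
  simp only [T]; rw [pow_succ' (c * b * a), mul_assoc (c * b * a)]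

/-- A left multiple by `z` can be moved to the front. -/
theorem z_front (h : Pl a b c) (i j k : ℕ) (x : N) :
    (c * b * a) ^ i * ((b * a) ^ j * ((c * a) ^ k * (c * b * a * x))) =
    (c * b * a) ^ (i + 1) * ((b * a) ^ j * ((c * a) ^ k * x)) := by
  have h1 : Commute (c * b * a) ((b * a) ^ j) := (h.z_b.mul_right h.z_a).pow_right j
  have h2 : Commute (c * b * a) ((c * a) ^ k) := (h.z_c.mul_right h.z_a).pow_right k
  rw [← mul_assoc ((c * a) ^ k), ← h2.eq, mul_assoc (c * b * a) ((c * a) ^ k),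
    ← mul_assoc ((b * a) ^ j), ← h1.eq, mul_assoc (c * b * a) ((b * a) ^ j), ← mul_assoc, ← pow_succ]

theorem z_front' (h : Pl a b c) (i j k l : ℕ) (x : N) :
    (c * b * a) ^ i * ((b * a) ^ j * ((c * a) ^ k * ((c * b) ^ l * (c * b * a * x)))) =
    (c * b * a) ^ (i + 1) * ((b * a) ^ j * ((c * a) ^ k * ((c * b) ^ l * x))) := by
  have h1 : Commute (c * b * a) ((c * b) ^ l) := (h.z_c.mul_right h.z_b).pow_right l
  rw [← h.z_front, ← mul_assoc ((c * b) ^ l), ← h1.eq, mul_assoc (c * b * a)]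

theorem T_c (i j k l m n p : ℕ) :
    T a b c i j k l m n p * c = T a b c i j k l m n (p + 1) := by
  simp only [T, pow_succ c, mul_assoc]

theorem T_b (h : Pl a b c) (i j k l m n p : ℕ) (hlm : l = 0 ∨ m = 0) :
    ∃ i' j' k' l' m' n' p', (l' = 0 ∨ m' = 0) ∧
      T a b c i j k l m n p * b = T a b c i' j' k' l' m' n' p' := by
  rcases p with _ | p
  · exact ⟨i, j, k, l, m, n + 1, 0, hlm, by simp only [T, pow_succ b, pow_zero, mul_one, mul_assoc]⟩
  have key : a ^ m * (b ^ n * (c ^ (p + 1) * b)) = a ^ m * (c * b) * (b ^ n * c ^ p) := by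
    rw [h.cpow_b, ← mul_assoc (b ^ n), (h.b_cb.pow_left n).eq]; simp only [mul_assoc]
  rcases m with _ | m
  · refine ⟨i, j, k, l + 1, 0, n, p, Or.inr rfl, ?_⟩
    have : T a b c i j k l 0 n (p + 1) * b = (c * b * a) ^ i * ((b * a) ^ j * ((c * a) ^ k *
      ((c * b) ^ l * (a ^ 0 * (b ^ n * (c ^ (p + 1) * b)))))) := by simp only [T, mul_assoc]
    rw [this, key]
    simp only [T, pow_zero, one_mul, pow_succ (c * b), mul_assoc]
  · obtain rfl : l = 0 := by omega
    refine ⟨i, j, k + 1, 0, m, n + 1, p, Or.inl rfl, ?_⟩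
    have : T a b c i j k 0 (m + 1) n (p + 1) * b = (c * b * a) ^ i * ((b * a) ^ j * ((c * a) ^ k *
      ((c * b) ^ 0 * (a ^ (m + 1) * (b ^ n * (c ^ (p + 1) * b)))))) := by simp only [T, mul_assoc]
    rw [this, key, h.apow_cb]
    simp only [T, pow_zero, one_mul, pow_succ (c * a), pow_succ' b, mul_assoc]

theorem T_a (h : Pl a b c) (i j k l m n p : ℕ) (hlm : l = 0 ∨ m = 0) :
    ∃ i' j' k' l' m' n' p', (l' = 0 ∨ m' = 0) ∧
      T a b c i j k l m n p * a = T a b c i' j' k' l' m' n' p' := by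
  have unf : ∀ n p, T a b c i j k l m n p * a = (c * b * a) ^ i * ((b * a) ^ j * ((c * a) ^ k *
      ((c * b) ^ l * (a ^ m * (b ^ n * c ^ p * a))))) := by
    intro n p; simp only [T, mul_assoc]
  rcases n with _ | n
  · rcases p with _ | p
    · rcases l with _ | l
      · exact ⟨i, j, k, 0, m + 1, 0, 0, Or.inl rfl, by
          simp only [T, pow_succ a, pow_zero, mul_one, mul_assoc]⟩
      · obtain rfl : m = 0 := by omega
        refine ⟨i + 1, j, k, l, 0, 0, 0, Or.inr rfl, ?_⟩
        rw [unf]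
        have := h.z_front' i j k l 1
        simp only [T, pow_zero, one_mul, mul_one, pow_succ (c * b), mul_assoc] at this ⊢
        exact this
    · have key : a ^ m * (b ^ 0 * c ^ (p + 1) * a) = c * a * (a ^ m * c ^ p) := by
        rw [pow_zero, one_mul, h.cpow_a, ← mul_assoc, (h.a_ca.pow_left m).eq, mul_assoc]
      rw [unf, key]
      rcases l with _ | l
      · refine ⟨i, j, k + 1, 0, m, 0, p, Or.inl rfl, ?_⟩
        simp only [T, pow_zero, one_mul, pow_succ (c * a), mul_assoc]
      · obtain rfl : m = 0 := by omega
        refine ⟨i + 1, j, k, l, 0, 0, p + 1, Or.inr rfl, ?_⟩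
        simp only [T]
        rw [pow_succ (c * b), mul_assoc ((c * b) ^ l), ← mul_assoc (c * b), h.cb_ca,
          mul_assoc (c * b * a), h.z_front']
        simp only [pow_zero, one_mul, pow_succ' c]
  · have key : a ^ m * (b ^ (n + 1) * c ^ p * a) = b * a * (a ^ m * (b ^ n * c ^ p)) := by
      rw [h.bpow_cpow_a, mul_assoc (b * a), ← mul_assoc, (h.a_ba.pow_left m).eq, mul_assoc]
    rw [unf, key]
    rcases l with _ | l
    · rcases k with _ | k
      · refine ⟨i, j + 1, 0, 0, m, n, p, Or.inl rfl, ?_⟩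
        simp only [T, pow_zero, one_mul, pow_succ (b * a), mul_assoc]
      · refine ⟨i + 1, j, k, 0, m + 1, n, p, Or.inl rfl, ?_⟩
        simp only [T]
        rw [pow_zero, one_mul, pow_succ (c * a), mul_assoc ((c * a) ^ k), ← mul_assoc (c * a),
          h.ca_ba, mul_assoc (c * b * a), h.z_front, pow_succ' a]
        simp only [one_mul, mul_assoc]
    · obtain rfl : m = 0 := by omega
      refine ⟨i + 1, j, k, l, 0, n + 1, p, Or.inr rfl, ?_⟩
      simp only [T]
      rw [pow_succ (c * b), mul_assoc ((c * b) ^ l), ← mul_assoc (c * b), h.cb_ba,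
          mul_assoc (c * b * a), h.z_front', pow_succ' b]
      simp only [pow_zero, one_mul, mul_assoc]

/-! ### The extra grammic relation -/

theorem ca_b_pow (h : Pl a b c) (k d : ℕ) :
    (c * a) ^ k * b ^ (k + d) = a ^ k * ((c * b) ^ k * b ^ d) := by
  induction k with
  | zero => simp
  | succ k ih =>
    have e1 : (c * a) ^ (k + 1) * b ^ (k + 1 + d) = c * a * ((c * a) ^ k * b ^ (k + d)) * b := by
      rw [show k + 1 + d = k + d + 1 by ring, pow_succ b, pow_succ' (c * a)]
      simp only [mul_assoc]
    have e2 : (c * b) ^ k * b ^ d * b = b * ((c * b) ^ k * b ^ d) := by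
      have : Commute b ((c * b) ^ k * b ^ d) :=
        (h.b_cb.pow_right k).mul_right ((Commute.refl b).pow_right d)
      exact this.eq.symm
    rw [e1, ih, mul_assoc, mul_assoc (a ^ k), e2, ← mul_assoc, ← (h.a_ca.pow_left k).eq,
      mul_assoc, ← mul_assoc (c * a), ← h.acb, pow_succ a, pow_succ' (c * b)]
    simp only [mul_assoc]

/-- Consequence of the grammic relation. -/
theorem gr_core (h : Pl a b c) (g : b * a * c * b = c * b * a * b) (k d : ℕ) :
    b * a * ((c * a) ^ (k + 1) * b ^ (k + 1 + d)) =
      c * b * a * ((c * a) ^ k * (a * b ^ (k + 1 + d))) := by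
  have g' : b * a * (c * b) = c * b * a * b := by rw [← g]; simp only [mul_assoc]
  have e : (c * a) ^ k * (a * b ^ (k + 1 + d)) = a ^ (k + 1) * ((c * b) ^ k * b ^ (d + 1)) := by
    rw [← mul_assoc, ← (h.a_ca.pow_right k).eq, mul_assoc, show k + 1 + d = k + (d + 1) by ring,
      h.ca_b_pow, pow_succ' a, mul_assoc]
  calc b * a * ((c * a) ^ (k + 1) * b ^ (k + 1 + d))
      = (b * a * a ^ (k + 1)) * ((c * b) ^ (k + 1) * b ^ d) := by
        rw [h.ca_b_pow]; simp only [mul_assoc]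
    _ = a ^ (k + 1) * (b * a * (c * b)) * ((c * b) ^ k * b ^ d) := by
        rw [← (h.a_ba.pow_left (k + 1)).eq, pow_succ' (c * b)]; simp only [mul_assoc]
    _ = (a ^ (k + 1) * (c * b * a)) * (b * (c * b) ^ k * b ^ d) := by
        rw [g']; simp only [mul_assoc]
    _ = c * b * a * (a ^ (k + 1) * ((c * b) ^ k * b ^ (d + 1))) := by
        rw [← (h.z_a.pow_right (k + 1)).eq, (h.b_cb.pow_right k).eq, pow_succ' b]
        simp only [mul_assoc]
    _ = _ := by rw [e]

theorem red1 (h : Pl a b c) (g : b * a * c * b = c * b * a * b) (i j k m d p : ℕ) :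
    T a b c i (j + 1) (k + 1) 0 m (k + 1 + d) p = T a b c (i + 1) j k 0 (m + 1) (k + 1 + d) p := by
  have e1 : T a b c i (j + 1) (k + 1) 0 m (k + 1 + d) p =
      (c * b * a) ^ i * ((b * a) ^ j * (a ^ m *
        (b * a * ((c * a) ^ (k + 1) * b ^ (k + 1 + d))) * c ^ p)) := by
    rw [← mul_assoc (a ^ m), (h.a_ba.pow_left m).eq, mul_assoc (b * a), ← mul_assoc (a ^ m),
      ((h.a_ca.pow_left m).pow_right (k + 1)).eq]
    simp only [T, pow_zero, one_mul, pow_succ (b * a), mul_assoc]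
  have e2 := h.z_front i j 0 (a ^ m * ((c * a) ^ k * (a * b ^ (k + 1 + d))) * c ^ p)
  rw [e1, h.gr_core g, ← mul_assoc (a ^ m), ← (h.z_a.pow_right m).eq, mul_assoc (c * b * a),
    mul_assoc (c * b * a)]
  simp only [pow_zero, one_mul] at e2
  rw [e2, ← mul_assoc (a ^ m), ((h.a_ca.pow_left m).pow_right k).eq]
  simp only [T, pow_zero, one_mul, pow_succ a, mul_assoc]

theorem red2 (h : Pl a b c) (g : b * a * c * b = c * b * a * b) (i j k l d p : ℕ) :
    T a b c i (j + 1) k (l + 1) 0 (k + d) p = T a b c (i + 1) j k l 0 (k + d + 1) p := by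
  have g' : b * a * (c * b) = c * b * a * b := by rw [← g]; simp only [mul_assoc]
  have core : b * a * ((c * a) ^ k * b ^ (k + d) * (c * b)) =
      c * b * a * ((c * a) ^ k * b ^ (k + d + 1)) := by
    calc b * a * ((c * a) ^ k * b ^ (k + d) * (c * b))
        = (b * a * a ^ k) * ((c * b) ^ k * (b ^ d * (c * b))) := by
          rw [h.ca_b_pow]; simp only [mul_assoc]
      _ = (a ^ k * (b * a)) * ((c * b) ^ (k + 1) * b ^ d) := by
          rw [← (h.a_ba.pow_left k).eq, (h.b_cb.pow_left d).eq, pow_succ (c * b)]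
          simp only [mul_assoc]
      _ = a ^ k * (b * a * (c * b)) * ((c * b) ^ k * b ^ d) := by
          rw [pow_succ' (c * b)]; simp only [mul_assoc]
      _ = (a ^ k * (c * b * a)) * (b * (c * b) ^ k * b ^ d) := by
          rw [g']; simp only [mul_assoc]
      _ = c * b * a * (a ^ k * ((c * b) ^ k * b ^ (d + 1))) := by
          rw [← (h.z_a.pow_right k).eq, (h.b_cb.pow_right k).eq, pow_succ' b]
          simp only [mul_assoc]
      _ = _ := by rw [← h.ca_b_pow, ← add_assoc]
  have cm : ∀ n r, (c * b) ^ r * b ^ n = b ^ n * (c * b) ^ r := fun n r =>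
    ((h.b_cb.pow_left n).pow_right r).eq.symm
  have e1 : T a b c i (j + 1) k (l + 1) 0 (k + d) p =
      (c * b * a) ^ i * ((b * a) ^ j *
        (b * a * ((c * a) ^ k * b ^ (k + d) * (c * b)) * ((c * b) ^ l * c ^ p))) := by
    simp only [T, pow_zero, one_mul]
    rw [← mul_assoc (_ ^ (l + 1)), cm, pow_succ' (c * b)]
    simp only [pow_succ (b * a), mul_assoc]
  have e2 := h.z_front i j 0 ((c * a) ^ k * b ^ (k + d + 1) * ((c * b) ^ l * c ^ p))
  simp only [pow_zero, one_mul] at e2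
  rw [e1, core, mul_assoc (c * b * a), e2, mul_assoc ((c * a) ^ k), ← mul_assoc (b ^ _), ← cm]
  simp only [T, pow_zero, one_mul, mul_assoc]

theorem gr_normal (h : Pl a b c) (g : b * a * c * b = c * b * a * b) (j : ℕ) :
    ∀ i k l m n p : ℕ, (l = 0 ∨ m = 0) →
    ∃ i' j' k' l' m' n' p', (l' = 0 ∨ m' = 0) ∧ (k' ≤ n' → j' = 0 ∨ (k' = 0 ∧ l' = 0)) ∧
      T a b c i j k l m n p = T a b c i' j' k' l' m' n' p' := by
  induction j with
  | zero => exact fun i k l m n p hl => ⟨i, 0, k, l, m, n, p, hl, fun _ => Or.inl rfl, rfl⟩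
  | succ j ih =>
    intro i k l m n p hl
    by_cases hk : k ≤ n
    · obtain ⟨d, rfl⟩ := Nat.exists_eq_add_of_le hk
      rcases l with _ | l
      · rcases k with _ | k
        · exact ⟨i, j + 1, 0, 0, m, _, p, hl, fun _ => Or.inr ⟨rfl, rfl⟩, rfl⟩
        · rw [h.red1 g]
          exact ih _ _ _ _ _ _ (Or.inl rfl)
      · obtain rfl : m = 0 := by omega
        rw [h.red2 g]
        exact ih _ _ _ _ _ _ (Or.inr rfl)
    · exact ⟨i, j + 1, k, l, m, n, p, hl, fun h => absurd h hk, rfl⟩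

/-! ### Normal forms when `a` and `c` commute -/

/-- Normal form for `N1`. -/
def T1 (a b c : N) (i j r s t u : ℕ) : N :=
  (c * b * a) ^ i * ((b * a) ^ j * (a ^ r * ((c * b) ^ s * (b ^ t * c ^ u))))

theorem z_T1 (i j r s t u : ℕ) :
    (c * b * a) * T1 a b c i j r s t u = T1 a b c (i + 1) j r s t u := by
  simp only [T1]; rw [pow_succ' (c * b * a), mul_assoc (c * b * a)]

theorem T1_c (i j r s t u : ℕ) : T1 a b c i j r s t u * c = T1 a b c i j r s t (u + 1) := by
  simp only [T1, pow_succ c, mul_assoc]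

theorem T1_b (h : Pl a b c) (i j r s t u : ℕ) :
    ∃ i' j' r' s' t' u', T1 a b c i j r s t u * b = T1 a b c i' j' r' s' t' u' := by
  rcases u with _ | u
  · exact ⟨i, j, r, s, t + 1, 0, by simp only [T1, pow_succ b, pow_zero, mul_one, mul_assoc]⟩
  · refine ⟨i, j, r, s + 1, t, u, ?_⟩
    have : T1 a b c i j r s t (u + 1) * b = (c * b * a) ^ i * ((b * a) ^ j * (a ^ r *
      ((c * b) ^ s * (b ^ t * (c ^ (u + 1) * b))))) := by simp only [T1, mul_assoc]
    rw [this, h.cpow_b, ← mul_assoc (b ^ t), (h.b_cb.pow_left t).eq]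
    simp only [T1, pow_succ (c * b), mul_assoc]

theorem T1_a (h : Pl a b c) (g : a * c = c * a) (i j r s t u : ℕ) :
    ∃ i' j' r' s' t' u', T1 a b c i j r s t u * a = T1 a b c i' j' r' s' t' u' := by
  have hc : Commute a c := g
  have unf : T1 a b c i j r s t u * a = (c * b * a) ^ i * ((b * a) ^ j * (a ^ r *
      ((c * b) ^ s * (b ^ t * (a * c ^ u))))) := by
    rw [(hc.pow_right u).eq]; simp only [T1, mul_assoc]
  have zf : ∀ s x, (c * b * a) ^ i * ((b * a) ^ j * (a ^ r * ((c * b) ^ s * (c * b * a * x)))) =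
      (c * b * a) ^ (i + 1) * ((b * a) ^ j * (a ^ r * ((c * b) ^ s * x))) := by
    intro s x
    have h1 : Commute (c * b * a) ((c * b) ^ s) := (h.z_c.mul_right h.z_b).pow_right s
    have h2 : Commute (c * b * a) (a ^ r) := h.z_a.pow_right r
    have := h.z_front i j 0 (a ^ r * ((c * b) ^ s * x))
    simp only [pow_zero, one_mul] at this
    rw [← this, ← mul_assoc ((c * b) ^ s), ← h1.eq, mul_assoc (c * b * a) ((c * b) ^ s),
      ← mul_assoc (a ^ r), ← h2.eq, mul_assoc (c * b * a) (a ^ r)]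
  rw [unf]
  rcases s with _ | s
  · rcases t with _ | t
    · exact ⟨i, j, r + 1, 0, 0, u, by simp only [T1, pow_succ a, pow_zero, one_mul, mul_assoc]⟩
    · refine ⟨i, j + 1, r, 0, t, u, ?_⟩
      rw [← mul_assoc (b ^ _), h.bpow_a, pow_zero, one_mul, mul_assoc (b * a), ← mul_assoc (a ^ r),
        (h.a_ba.pow_left r).eq]
      simp only [T1, pow_succ (b * a), pow_zero, one_mul, mul_assoc]
  · refine ⟨i + 1, j, r, s, t, u, ?_⟩
    rcases t with _ | t
    · have := zf s (c ^ u)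
      simp only [T1, pow_succ (c * b), pow_zero, one_mul, mul_assoc] at this ⊢
      exact this
    · rw [← mul_assoc (b ^ _), h.bpow_a, mul_assoc (b * a), pow_succ (c * b),
        mul_assoc ((c * b) ^ s), ← mul_assoc (c * b), h.cb_ba, mul_assoc (c * b * a), zf]
      simp only [T1, pow_succ' b, mul_assoc]

end Pl

/-! ### Automata giving invariants -/

section Run
variable {S : Type*}

/-- Run a word through an automaton. -/
def run (step : S → Fin 3 → S) (s : S) (w : FreeMonoid (Fin 3)) : S :=
  w.toList.foldl step s

@[simp] theorem run_mul (step : S → Fin 3 → S) (s : S) (u v : FreeMonoid (Fin 3)) :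
    run step s (u * v) = run step (run step s u) v := by
  simp [run]

@[simp] theorem run_one (step : S → Fin 3 → S) (s : S) : run step s 1 = s := rfl
@[simp] theorem run_a (step : S → Fin 3 → S) (s : S) : run step s a = step s 0 := rfl
@[simp] theorem run_b (step : S → Fin 3 → S) (s : S) : run step s b = step s 1 := rfl
@[simp] theorem run_c (step : S → Fin 3 → S) (s : S) : run step s c = step s 2 := rfl

theorem run_valid (step : S → Fin 3 → S) (P : S → Prop) (hP : ∀ s x, P s → P (step s x))
    (w : FreeMonoid (Fin 3)) : ∀ s, P s → P (run step s w) := by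
  induction w using FreeMonoid.recOn with
  | one => intro s hs; exact hs
  | of_mul x xs ih => intro s hs; rw [run_mul]; exact ih _ (hP _ _ hs)

/-- Congruence of words acting equally on valid states. -/
def runCon (step : S → Fin 3 → S) (P : S → Prop) (hP : ∀ s x, P s → P (step s x)) :
    Con (FreeMonoid (Fin 3)) where
  r u v := ∀ s, P s → run step s u = run step s v
  iseqv := ⟨fun _ _ _ => rfl, fun h s hs => (h s hs).symm, fun h k s hs => (h s hs).trans (k s hs)⟩
  mul' := by
    intro u u' v v' h k s hs
    rw [run_mul, run_mul, h s hs, k _ (run_valid step P hP _ _ hs)]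

theorem run_eq (step : S → Fin 3 → S) (P : S → Prop) (hP : ∀ s x, P s → P (step s x))
    (x y : FreeMonoid (Fin 3))
    (hk : ∀ u v, KnuthRel u v → ∀ s, P s → run step s u = run step s v)
    (hxy : ∀ s, P s → run step s x = run step s y) (u v : FreeMonoid (Fin 3))
    (h : (conGen (fun x' y' => x' = mk x ∧ y' = mk y) : Con M).mk' (mk u) =
      (conGen (fun x' y' => x' = mk x ∧ y' = mk y) : Con M).mk' (mk v)) (s : S) (hs : P s) :
    run step s u = run step s v := by
  have h1 : placticCon ≤ Con.ker (runCon step P hP).mk' := by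
    refine Con.conGen_le.2 ?_
    intro u v huv
    exact (Con.eq _).2 (hk u v huv)
  let f : M →* (runCon step P hP).Quotient := placticCon.lift _ h1
  have h2 : conGen (fun x' y' => x' = mk x ∧ y' = mk y) ≤ Con.ker f := by
    refine Con.conGen_le.2 ?_
    rintro _ _ ⟨rfl, rfl⟩
    exact (Con.eq (runCon step P hP)).2 hxy
  have h3 : f (mk u) = f (mk v) := h2 ((Con.eq _).1 h)
  exact (Con.eq (runCon step P hP)).1 h3 s hs

end Run

/-- States of the automata. -/
@[ext] structure St where
  (x1 x2 x3 x4 x5 x6 : ℕ)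

/-- Automaton for `N1`: the action on normal forms. -/
def step1 (s : St) (x : Fin 3) : St :=
  if x = 0 then
    if 0 < s.x4 then ⟨s.x1 + 1, s.x2, s.x3, s.x4 - 1, s.x5, s.x6⟩
    else if 0 < s.x5 then ⟨s.x1, s.x2 + 1, s.x3, s.x4, s.x5 - 1, s.x6⟩
    else ⟨s.x1, s.x2, s.x3 + 1, s.x4, s.x5, s.x6⟩
  else if x = 1 then
    if 0 < s.x6 then ⟨s.x1, s.x2, s.x3, s.x4 + 1, s.x5, s.x6 - 1⟩
    else ⟨s.x1, s.x2, s.x3, s.x4, s.x5 + 1, s.x6⟩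
  else ⟨s.x1, s.x2, s.x3, s.x4, s.x5, s.x6 + 1⟩

/-- Automaton for `N2`: lengths of longest nondecreasing subwords over the intervals
`a`, `b`, `c`, `ab`, `bc`, `abc`. -/
def step2 (s : St) (x : Fin 3) : St :=
  if x = 0 then
    ⟨s.x1 + 1, s.x2, s.x3, max s.x4 (s.x1 + 1), s.x5, max s.x6 (s.x1 + 1)⟩
  else if x = 1 then
    ⟨s.x1, s.x2 + 1, s.x3, s.x4 + 1, max s.x5 (s.x2 + 1), max s.x6 (s.x4 + 1)⟩
  else ⟨s.x1, s.x2, s.x3 + 1, s.x4, s.x5 + 1, s.x6 + 1⟩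

/-- Valid states for `step2`. -/
def Valid (s : St) : Prop :=
  s.x1 ≤ s.x4 ∧ s.x2 ≤ s.x4 ∧ s.x2 ≤ s.x5 ∧ s.x3 ≤ s.x5 ∧ s.x4 ≤ s.x6 ∧ s.x5 ≤ s.x6

theorem valid_step2 (s : St) (x : Fin 3) (h : Valid s) : Valid (step2 s x) := by
  obtain ⟨h1, h2, h3, h4, h5, h6⟩ := h
  fin_cases x <;> simp only [Valid, step2] <;> simp <;> omega

theorem knuth1 (u v : FreeMonoid (Fin 3)) (h : KnuthRel u v) (s : St) :
    run step1 s u = run step1 s v := by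
  obtain ⟨i, j, r, p, q, t⟩ := s
  cases h <;> simp only [run_mul, run_a, run_b, run_c] <;>
    rcases p with _ | _ | p <;> rcases q with _ | _ | q <;> rcases t with _ | _ | t <;>
    simp [step1]

theorem extra1 (s : St) : run step1 s (a * c) = run step1 s (c * a) := by
  obtain ⟨i, j, r, p, q, t⟩ := s
  simp only [run_mul, run_a, run_c]
  rcases p with _ | p <;> rcases q with _ | q <;> simp [step1]

set_option maxHeartbeats 4000000 in
theorem knuth2 (u v : FreeMonoid (Fin 3)) (h : KnuthRel u v) (s : St) (hs : Valid s) :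
    run step2 s u = run step2 s v := by
  obtain ⟨A, B, C, X, Z, Y⟩ := s
  obtain ⟨h1, h2, h3, h4, h5, h6⟩ := hs
  simp only at h1 h2 h3 h4 h5 h6
  cases h <;> simp only [run_mul, run_a, run_b, run_c, step2, St.mk.injEq, if_true, one_ne_zero,
    Fin.reduceEq, if_false] <;> refine ⟨?_, ?_, ?_, ?_, ?_, ?_⟩ <;> grind

theorem extra2 (s : St) (hs : Valid s) :
    run step2 s (b * a * c * b) = run step2 s (c * b * a * b) := by
  obtain ⟨h1, h2, h3, h4, h5, h6⟩ := hs
  ext <;> simp [step2] <;> omega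

theorem run_pow_succ {S : Type*} (step : S → Fin 3 → S) (s : S) (w : FreeMonoid (Fin 3)) (n : ℕ) :
    run step s (w ^ (n + 1)) = run step (run step s (w ^ n)) w := by
  rw [pow_succ, run_mul]

theorem run1_T1 (i j r p q t : ℕ) :
    run step1 ⟨0, 0, 0, 0, 0, 0⟩ (Pl.T1 a b c i j r p q t) = ⟨i, j, r, p, q, t⟩ := by
  have e1 : ∀ i, run step1 ⟨0, 0, 0, 0, 0, 0⟩ ((c * b * a) ^ i) = ⟨i, 0, 0, 0, 0, 0⟩ := by
    intro i; induction i with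
    | zero => rfl
    | succ i ih => rw [run_pow_succ, ih]; simp [step1]
  have e2 : ∀ j, run step1 ⟨i, 0, 0, 0, 0, 0⟩ ((b * a) ^ j) = ⟨i, j, 0, 0, 0, 0⟩ := by
    intro i; induction i with
    | zero => rfl
    | succ i ih => rw [run_pow_succ, ih]; simp [step1]
  have e3 : ∀ r, run step1 ⟨i, j, 0, 0, 0, 0⟩ (a ^ r) = ⟨i, j, r, 0, 0, 0⟩ := by
    intro i; induction i with
    | zero => rfl
    | succ i ih => rw [run_pow_succ, ih]; simp [step1]
  have e4 : ∀ p, run step1 ⟨i, j, r, 0, 0, 0⟩ ((c * b) ^ p) = ⟨i, j, r, p, 0, 0⟩ := by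
    intro i; induction i with
    | zero => rfl
    | succ i ih => rw [run_pow_succ, ih]; simp [step1]
  have e5 : ∀ q, run step1 ⟨i, j, r, p, 0, 0⟩ (b ^ q) = ⟨i, j, r, p, q, 0⟩ := by
    intro i; induction i with
    | zero => rfl
    | succ i ih => rw [run_pow_succ, ih]; simp [step1]
  have e6 : ∀ t, run step1 ⟨i, j, r, p, q, 0⟩ (c ^ t) = ⟨i, j, r, p, q, t⟩ := by
    intro i; induction i with
    | zero => rfl
    | succ i ih => rw [run_pow_succ, ih]; simp [step1]
  simp only [Pl.T1]
  rw [run_mul, e1, run_mul, e2, run_mul, e3, run_mul, e4, run_mul, e5, e6]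

theorem run2_T (i j k l m n p : ℕ) :
    run step2 ⟨0, 0, 0, 0, 0, 0⟩ (Pl.T a b c i j k l m n p) =
      ⟨i + j + k + m, i + j + l + n, i + k + l + p, i + j + k + max l m + n,
        i + j + l + max k n + p, i + j + k + max l m + n + p⟩ := by
  have e1 : ∀ i, run step2 ⟨0, 0, 0, 0, 0, 0⟩ ((c * b * a) ^ i) = ⟨i, i, i, i, i, i⟩ := by
    intro i; induction i with
    | zero => rfl
    | succ i ih => rw [run_pow_succ, ih]; simp [step2]
  have e2 : ∀ j, run step2 ⟨i, i, i, i, i, i⟩ ((b * a) ^ j) =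
      ⟨i + j, i + j, i, i + j, i + j, i + j⟩ := by
    intro j; induction j with
    | zero => rfl
    | succ j ih => rw [run_pow_succ, ih]; ext <;> simp [step2] <;> omega
  have e3 : ∀ k, run step2 ⟨i + j, i + j, i, i + j, i + j, i + j⟩ ((c * a) ^ k) =
      ⟨i + j + k, i + j, i + k, i + j + k, i + j + k, i + j + k⟩ := by
    intro j; induction j with
    | zero => rfl
    | succ j ih => rw [run_pow_succ, ih]; ext <;> simp [step2] <;> omega
  have e4 : ∀ l, run step2 ⟨i + j + k, i + j, i + k, i + j + k, i + j + k, i + j + k⟩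
      ((c * b) ^ l) =
      ⟨i + j + k, i + j + l, i + k + l, i + j + k + l, i + j + k + l, i + j + k + l⟩ := by
    intro j; induction j with
    | zero => rfl
    | succ j ih => rw [run_pow_succ, ih]; ext <;> simp [step2] <;> omega
  have e5 : ∀ m, run step2
      ⟨i + j + k, i + j + l, i + k + l, i + j + k + l, i + j + k + l, i + j + k + l⟩ (a ^ m) =
      ⟨i + j + k + m, i + j + l, i + k + l, i + j + k + max l m, i + j + k + l,
        i + j + k + max l m⟩ := by
    intro j; induction j with
    | zero => ext <;> simp
    | succ j ih => rw [run_pow_succ, ih]; ext <;> simp [step2] <;> omega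
  have e6 : ∀ n, run step2 ⟨i + j + k + m, i + j + l, i + k + l, i + j + k + max l m,
      i + j + k + l, i + j + k + max l m⟩ (b ^ n) =
      ⟨i + j + k + m, i + j + l + n, i + k + l, i + j + k + max l m + n, i + j + l + max k n,
        i + j + k + max l m + n⟩ := by
    intro j; induction j with
    | zero => ext <;> simp <;> omega
    | succ j ih => rw [run_pow_succ, ih]; ext <;> simp [step2] <;> omega
  have e7 : ∀ p, run step2 ⟨i + j + k + m, i + j + l + n, i + k + l, i + j + k + max l m + n,
      i + j + l + max k n, i + j + k + max l m + n⟩ (c ^ p) =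
      ⟨i + j + k + m, i + j + l + n, i + k + l + p, i + j + k + max l m + n,
        i + j + l + max k n + p, i + j + k + max l m + n + p⟩ := by
    intro j; induction j with
    | zero => rfl
    | succ j ih => rw [run_pow_succ, ih]; ext <;> simp [step2] <;> omega
  simp only [Pl.T]
  rw [run_mul, e1, run_mul, e2, run_mul, e3, run_mul, e4, run_mul, e5, run_mul, e6, e7]

theorem mk_eq {u v : FreeMonoid (Fin 3)} (h : KnuthRel u v) : mk u = mk v :=
  (Con.eq placticCon).2 (ConGen.Rel.of _ _ h)

/-- The images of the generators in any quotient of `M` form a plactic triple. -/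
theorem pl_hom {N : Type*} [Monoid N] (f : M →* N) : Pl (f (mk a)) (f (mk b)) (f (mk c)) := by
  constructor <;> simp only [← map_mul] <;> congr 1 <;> apply mk_eq <;> constructor

theorem hom_ind {N : Type*} [Monoid N] (f : FreeMonoid (Fin 3) →* N) (P : N → Prop) (h1 : P 1)
    (ha : ∀ x, P x → P (x * f a)) (hb : ∀ x, P x → P (x * f b)) (hc : ∀ x, P x → P (x * f c))
    (w : FreeMonoid (Fin 3)) : ∀ x, P x → P (x * f w) := by
  induction w using FreeMonoid.recOn with
  | one => intro x hx; simpa using hx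
  | of_mul y ys ih =>
    intro x hx
    rw [map_mul, ← mul_assoc]
    apply ih
    fin_cases y
    · exact ha x hx
    · exact hb x hx
    · exact hc x hx

theorem part1 (w v : N1)
    (h : con1.mk' (mk (c * b * a)) * w = con1.mk' (mk (c * b * a)) * v) : w = v := by
  have hp := pl_hom con1.mk'
  have g : con1.mk' (mk a) * con1.mk' (mk c) = con1.mk' (mk c) * con1.mk' (mk a) := by
    simp only [← map_mul]
    exact (Con.eq con1).2 (ConGen.Rel.of _ _ ⟨rfl, rfl⟩)
  have tf : ∀ i j r s t u, Pl.T1 (con1.mk' (mk a)) (con1.mk' (mk b)) (con1.mk' (mk c)) i j r s t u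
      = con1.mk' (mk (Pl.T1 a b c i j r s t u)) := by
    intros; simp only [Pl.T1, map_mul, map_pow]
  have nf : ∀ w : N1, ∃ i j r s t u,
      w = Pl.T1 (con1.mk' (mk a)) (con1.mk' (mk b)) (con1.mk' (mk c)) i j r s t u := by
    intro w
    obtain ⟨w, rfl⟩ := con1.mk'_surjective w
    obtain ⟨w, rfl⟩ := placticCon.mk'_surjective w
    have := hom_ind (con1.mk'.comp mk) (fun w => ∃ i j r s t u,
      w = Pl.T1 (con1.mk' (mk a)) (con1.mk' (mk b)) (con1.mk' (mk c)) i j r s t u)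
      ⟨0, 0, 0, 0, 0, 0, by simp [Pl.T1]⟩
      (by rintro _ ⟨i, j, r, s, t, u, rfl⟩; exact hp.T1_a g i j r s t u)
      (by rintro _ ⟨i, j, r, s, t, u, rfl⟩; exact hp.T1_b i j r s t u)
      (by rintro _ ⟨i, j, r, s, t, u, rfl⟩; exact ⟨_, _, _, _, _, _, Pl.T1_c i j r s t u⟩)
      w 1 ⟨0, 0, 0, 0, 0, 0, by simp [Pl.T1]⟩
    rw [one_mul] at this
    exact this
  obtain ⟨i, j, r, s, t, u, rfl⟩ := nf w
  obtain ⟨i', j', r', s', t', u', rfl⟩ := nf v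
  simp only [map_mul, Pl.z_T1] at h
  rw [tf, tf] at h
  have := run_eq step1 (fun _ => True) (fun _ _ _ => trivial) (a * c) (c * a)
    (fun u v h s _ => knuth1 u v h s) (fun s _ => extra1 s) _ _ h ⟨0, 0, 0, 0, 0, 0⟩ trivial
  rw [run1_T1, run1_T1] at this
  simp only [St.mk.injEq] at this
  obtain ⟨h1, rfl, rfl, rfl, rfl, rfl⟩ := this
  obtain rfl : i = i' := by omega
  rfl

/-- The invariants separate normal forms. -/
theorem params_unique (i j k l m n p i' j' k' l' m' n' p' : ℕ)
    (h1 : l = 0 ∨ m = 0) (h2 : k ≤ n → j = 0 ∨ (k = 0 ∧ l = 0))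
    (h1' : l' = 0 ∨ m' = 0) (h2' : k' ≤ n' → j' = 0 ∨ (k' = 0 ∧ l' = 0))
    (q1 : i + 1 + j + k + m = i' + 1 + j' + k' + m')
    (q2 : i + 1 + j + l + n = i' + 1 + j' + l' + n')
    (q3 : i + 1 + k + l + p = i' + 1 + k' + l' + p')
    (q4 : i + 1 + j + k + max l m + n = i' + 1 + j' + k' + max l' m' + n')
    (q5 : i + 1 + j + l + max k n + p = i' + 1 + j' + l' + max k' n' + p')
    (q6 : i + 1 + j + k + max l m + n + p = i' + 1 + j' + k' + max l' m' + n' + p') :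
    i = i' ∧ j = j' ∧ k = k' ∧ l = l' ∧ m = m' ∧ n = n' ∧ p = p' := by
  have hp : p = p' := by omega
  have e1 : max l m = l + m := by clear q4 q5 q6; omega
  have e1' : max l' m' = l' + m' := by clear q4 q5 q6; omega
  rw [e1, e1'] at q4
  clear q6 e1 e1'
  subst hp
  have hB : i + j = i' + j' := by clear q5; omega
  have hA : l + n = l' + n' := by omega
  have hC : k + m = k' + m' := by clear q5; omega
  rcases le_or_gt k n with hk | hk <;> rcases le_or_gt k' n' with hk' | hk'
  · rw [max_eq_right hk, max_eq_right hk'] at q5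
    rcases h2 hk with h2 | ⟨h2, h3⟩ <;> rcases h2' hk' with h2' | ⟨h2', h3'⟩ <;>
      rcases h1 with h1 | h1 <;> rcases h1' with h1' | h1' <;> omega
  · rw [max_eq_right hk, max_eq_left hk'.le] at q5
    omega
  · rw [max_eq_left hk.le, max_eq_right hk'] at q5
    omega
  · rw [max_eq_left hk.le, max_eq_left hk'.le] at q5
    clear h2 h2'
    rcases h1 with h1 | h1 <;> rcases h1' with h1' | h1' <;> omega

theorem part2 (w v : N2)
    (h : con2.mk' (mk (c * b * a)) * w = con2.mk' (mk (c * b * a)) * v) : w = v := by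
  have hp := pl_hom con2.mk'
  have g : con2.mk' (mk b) * con2.mk' (mk a) * con2.mk' (mk c) * con2.mk' (mk b) =
      con2.mk' (mk c) * con2.mk' (mk b) * con2.mk' (mk a) * con2.mk' (mk b) := by
    simp only [← map_mul]
    exact (Con.eq con2).2 (ConGen.Rel.of _ _ ⟨rfl, rfl⟩)
  have tf : ∀ i j k l m n p,
      Pl.T (con2.mk' (mk a)) (con2.mk' (mk b)) (con2.mk' (mk c)) i j k l m n p
      = con2.mk' (mk (Pl.T a b c i j k l m n p)) := by
    intros; simp only [Pl.T, map_mul, map_pow]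
  have nf : ∀ w : N2, ∃ i j k l m n p, (l = 0 ∨ m = 0) ∧ (k ≤ n → j = 0 ∨ (k = 0 ∧ l = 0)) ∧
      w = Pl.T (con2.mk' (mk a)) (con2.mk' (mk b)) (con2.mk' (mk c)) i j k l m n p := by
    intro w
    obtain ⟨w, rfl⟩ := con2.mk'_surjective w
    obtain ⟨w, rfl⟩ := placticCon.mk'_surjective w
    have := hom_ind (con2.mk'.comp mk) (fun w => ∃ i j k l m n p, (l = 0 ∨ m = 0) ∧
      w = Pl.T (con2.mk' (mk a)) (con2.mk' (mk b)) (con2.mk' (mk c)) i j k l m n p)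
      ⟨0, 0, 0, 0, 0, 0, 0, by simp, by simp [Pl.T]⟩
      (by rintro _ ⟨i, j, k, l, m, n, p, hl, rfl⟩; exact hp.T_a i j k l m n p hl)
      (by rintro _ ⟨i, j, k, l, m, n, p, hl, rfl⟩; exact hp.T_b i j k l m n p hl)
      (by rintro _ ⟨i, j, k, l, m, n, p, hl, rfl⟩
          exact ⟨_, _, _, _, _, _, _, hl, Pl.T_c i j k l m n p⟩)
      w 1 ⟨0, 0, 0, 0, 0, 0, 0, by simp, by simp [Pl.T]⟩
    rw [one_mul] at this
    obtain ⟨i, j, k, l, m, n, p, hl, e⟩ := this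
    obtain ⟨i', j', k', l', m', n', p', h1, h2, e'⟩ := hp.gr_normal g j i k l m n p hl
    exact ⟨i', j', k', l', m', n', p', h1, h2, e.trans e'⟩
  obtain ⟨i, j, k, l, m, n, p, h1, h2, rfl⟩ := nf w
  obtain ⟨i', j', k', l', m', n', p', h1', h2', rfl⟩ := nf v
  simp only [map_mul, Pl.z_T] at h
  rw [tf, tf] at h
  have := run_eq step2 Valid valid_step2 (b * a * c * b) (c * b * a * b)
    knuth2 extra2 _ _ h ⟨0, 0, 0, 0, 0, 0⟩ (by simp [Valid])
  rw [run2_T, run2_T] at this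
  simp only [St.mk.injEq] at this
  obtain ⟨q1, q2, q3, q4, q5, q6⟩ := this
  have : i = i' ∧ j = j' ∧ k = k' ∧ l = l' ∧ m = m' ∧ n = n' ∧ p = p' :=
    params_unique _ _ _ _ _ _ _ _ _ _ _ _ _ _ h1 h2 h1' h2' q1 q2 q3 q4 q5 q6
  obtain ⟨rfl, rfl, rfl, rfl, rfl, rfl, rfl⟩ := this
  rfl

/-- The image of `cba` is cancellable in `N1`, and likewise in `N2`. -/
theorem z_cancellable_in_quotients :
    (∀ w v : N1, con1.mk' (mk (c * b * a)) * w = con1.mk' (mk (c * b * a)) * v → w = v) ∧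
    (∀ w v : N2, con2.mk' (mk (c * b * a)) * w = con2.mk' (mk (c * b * a)) * v → w = v) :=
  ⟨part1, part2⟩

end Plactic
end

section
/- The plactic monoid M with three generators and the monoid N1 are equationally equivalent: for every type X and all words w, w' ∈ FreeMonoid X, M satisfies the identity w ≍ w' if and only if N1 satisfies the identity w ≍ w'. -/
namespace Plactic

/-- A monoid `S` satisfies the identity `w ≍ w'` if every monoid homomorphism
from the free monoid into `S` equalizes `w` and `w'`. -/
def SatisfiesId (S : Type*) [Monoid S] {X : Type*} (w w' : FreeMonoid X) : Prop :=
  ∀ φ : FreeMonoid X →* S, φ w = φ w'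

/-- The state of the counter machine: three registers and the content of the word. -/
abbrev St_s11 := ℕ × ℕ × ℕ × ℕ × ℕ × ℕ

/-- The action of the generators on states. -/
def step : Fin 3 → Function.End St_s11
  | 0 => fun s => (s.1 + 1, s.2.1, s.2.2.1, s.2.2.2.1 + 1, s.2.2.2.2.1, s.2.2.2.2.2)
  | 1 => fun s => (s.1 - 1, s.2.1 + (if s.1 = 0 then 0 else 1), s.2.2.1,
      s.2.2.2.1, s.2.2.2.2.1 + 1, s.2.2.2.2.2)
  | 2 => fun s => (s.1, s.2.1 - 1, s.2.2.1 + (if s.2.1 = 0 then 0 else 1),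
      s.2.2.2.1, s.2.2.2.2.1, s.2.2.2.2.2 + 1)

/-- The action of words on states (reading from right to left). -/
def W : FreeMonoid (Fin 3) →* Function.End St_s11 := FreeMonoid.lift step

lemma W_a (p q z x y t : ℕ) : W a (p, q, z, x, y, t) = (p + 1, q, z, x + 1, y, t) := by
  simp [W, a, step]

lemma W_b (p q z x y t : ℕ) : W b (p, q, z, x, y, t) =
    (p - 1, q + (if p = 0 then 0 else 1), z, x, y + 1, t) := by
  simp [W, b, step]

lemma W_c (p q z x y t : ℕ) : W c (p, q, z, x, y, t) =
    (p, q - 1, z + (if q = 0 then 0 else 1), x, y, t + 1) := by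
  simp [W, c, step]

lemma W_mul (u v : FreeMonoid (Fin 3)) (s : St_s11) : W (u * v) s = W u (W v s) := by
  rw [map_mul]; rfl

lemma W_one (s : St_s11) : W 1 s = s := by
  rw [map_one]; rfl

lemma W_ac : W (a * c) = W (c * a) := by
  funext ⟨p, q, z, x, y, t⟩
  simp only [W_mul, W_a, W_c]

lemma W_rel {u v : FreeMonoid (Fin 3)} (h : KnuthRel u v) : W u = W v := by
  funext ⟨p, q, z, x, y, t⟩
  cases h <;> simp only [W_mul, W_a, W_b, W_c, Prod.mk.injEq] <;> grind

/-- The action factors through the plactic monoid. -/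
def WM : M →* Function.End St_s11 :=
  placticCon.lift W (Con.conGen_le.2 fun _ _ h => W_rel h)

lemma WM_mk (u : FreeMonoid (Fin 3)) : WM (mk u) = W u := rfl

/-- The action factors through `N1`. -/
def WN : N1 →* Function.End St_s11 :=
  con1.lift WM (Con.conGen_le.2 fun x y h => by
    rw [Con.ker_rel, h.1, h.2, WM_mk, WM_mk, W_ac])

/-- The projection from the free monoid onto `N1`. -/
def mk1 : FreeMonoid (Fin 3) →* N1 := con1.mk'.comp mk

lemma WN_mk1 (u : FreeMonoid (Fin 3)) : WN (mk1 u) = W u := rfl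

/-- The second substitution `a ↦ ba, b ↦ ac, c ↦ cb`. -/
def theta : FreeMonoid (Fin 3) →* FreeMonoid (Fin 3) :=
  FreeMonoid.lift fun | 0 => b * a | 1 => a * c | 2 => c * b

lemma theta_a : theta a = b * a := by simp [theta, a]
lemma theta_b : theta b = a * c := by simp [theta, b]
lemma theta_c : theta c = c * b := by simp [theta, c]

/-- Normal forms. -/
def nf {S : Type*} [Monoid S] (a b c : S) (o n m l k j i : ℕ) : S :=
  a ^ o * (b ^ n * (c ^ m * ((b * a) ^ l * ((c * a) ^ k * ((c * b) ^ j * (c * b * a) ^ i)))))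


/-- The defining relations, in an arbitrary monoid. -/
structure Rels {S : Type*} [Monoid S] (a b c : S) : Prop where
  aba : a * b * a = b * a * a
  bab : b * a * b = b * b * a
  aca : a * c * a = c * a * a
  cac : c * a * c = c * c * a
  cbb : c * b * b = b * c * b
  cbc : c * b * c = c * c * b
  bac : b * a * c = b * c * a
  acb : a * c * b = c * a * b

/-- Existence of a normal form. -/
def IsNF {S : Type*} [Monoid S] (a b c x : S) : Prop :=
  ∃ o n m l k j i : ℕ, (l = 0 ∨ m = 0) ∧ x = nf a b c o n m l k j i

lemma comm_pow {S : Type*} [Monoid S] {u v : S} (h : u * v = v * u) (n : ℕ) (X : S) :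
    u * (v ^ n * X) = v ^ n * (u * X) := by
  have h' : Commute u v := h
  rw [← mul_assoc, (h'.pow_right n).eq, mul_assoc]

lemma pow_mul_self {S : Type*} [Monoid S] (u : S) (n : ℕ) (X : S) :
    u ^ n * (u * X) = u ^ (n + 1) * X := by
  rw [pow_succ, mul_assoc]

namespace Rels
variable {S : Type*} [Monoid S] {a b c : S} 

lemma b_ca (R : Rels a b c) (X : S) : b * (c * a * X) = b * a * (c * X) := by
  have := congrArg (· * X) R.bac
  simp only [mul_assoc] at this ⊢
  exact this.symm

lemma ca_b (R : Rels a b c) (X : S) : c * a * (b * X) = a * (c * b * X) := by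
  have := congrArg (· * X) R.acb
  simp only [mul_assoc] at this ⊢
  exact this.symm

lemma d_a (R : Rels a b c) : b * a * a = a * (b * a) := by rw [← R.aba, mul_assoc]
lemma d_b (R : Rels a b c) : b * a * b = b * (b * a) := by rw [R.bab, mul_assoc]
lemma e_a (R : Rels a b c) : c * a * a = a * (c * a) := by rw [← R.aca, mul_assoc]
lemma e_c (R : Rels a b c) : c * a * c = c * (c * a) := by rw [R.cac, mul_assoc]
lemma f_b (R : Rels a b c) : c * b * b = b * (c * b) := by rw [R.cbb, mul_assoc]
lemma f_c (R : Rels a b c) : c * b * c = c * (c * b) := by rw [R.cbc, mul_assoc]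

lemma Q_a (R : Rels a b c) : c * b * a * a = a * (c * b * a) := by
  rw [← mul_assoc, ← mul_assoc, R.acb, mul_assoc c a b, mul_assoc c (a * b) a, R.aba]
  simp only [mul_assoc]
lemma Q_b (R : Rels a b c) : c * b * a * b = b * (c * b * a) := by
  rw [← mul_assoc, ← mul_assoc, ← R.cbb, mul_assoc c b a, mul_assoc c (b * a) b, R.bab]
  simp only [mul_assoc]
lemma Q_c (R : Rels a b c) : c * b * a * c = c * (c * b * a) := by
  rw [← mul_assoc, ← mul_assoc, ← R.cbc, mul_assoc c b a, mul_assoc c (b * a) c, R.bac]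
  simp only [mul_assoc]

lemma Q_mul (_ : Rels a b c) {u v : S} (hu : c * b * a * u = u * (c * b * a)) (hv : c * b * a * v = v * (c * b * a)) :
    c * b * a * (u * v) = u * v * (c * b * a) := by
  rw [← mul_assoc, hu, mul_assoc u, hv, ← mul_assoc u]

lemma b_apow (R : Rels a b c) (X : S) (o : ℕ) : b * (a ^ (o + 1) * X) = a ^ o * (b * a * X) := by
  rw [pow_succ', mul_assoc, ← mul_assoc b, comm_pow R.d_a]
lemma c_apow (R : Rels a b c) (X : S) (o : ℕ) : c * (a ^ (o + 1) * X) = a ^ o * (c * a * X) := by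
  rw [pow_succ', mul_assoc, ← mul_assoc c, comm_pow R.e_a]
lemma c_bpow (R : Rels a b c) (X : S) (o : ℕ) : c * (b ^ (o + 1) * X) = b ^ o * (c * b * X) := by
  rw [pow_succ', mul_assoc, ← mul_assoc c, comm_pow R.f_b]
lemma d_cpow (R : Rels a b c) (X : S) (m : ℕ) : b * a * (c ^ (m + 1) * X) = b * (c ^ m * (c * a * X)) := by
  rw [pow_succ', mul_assoc c (c ^ m), ← R.b_ca, comm_pow R.e_c]
lemma e_bpow (R : Rels a b c) (X : S) (n : ℕ) : c * a * (b ^ (n + 1) * X) = a * (b ^ n * (c * b * X)) := by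
  rw [pow_succ', mul_assoc b (b ^ n), R.ca_b, comm_pow R.f_b]
lemma Q_d (R : Rels a b c) : c * b * a * (b * a) = b * a * (c * b * a) := R.Q_mul R.Q_b R.Q_a
lemma Q_e (R : Rels a b c) : c * b * a * (c * a) = c * a * (c * b * a) := R.Q_mul R.Q_c R.Q_a
lemma Q_f (R : Rels a b c) : c * b * a * (c * b) = c * b * (c * b * a) := R.Q_mul R.Q_c R.Q_b
lemma c_dpow (R : Rels a b c) (X : S) (l : ℕ) : c * ((b * a) ^ (l + 1) * X) = (b * a) ^ l * (c * b * a * X) := by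
  rw [pow_succ', ← comm_pow R.Q_d]; simp only [mul_assoc]
lemma f_dpow (R : Rels a b c) (X : S) (l : ℕ) : c * b * ((b * a) ^ (l + 1) * X) = b * ((b * a) ^ l * (c * b * a * X)) := by
  rw [pow_succ', ← comm_pow R.Q_d]
  have := congrArg (· * (a * ((b * a) ^ l * X))) R.cbb
  simp only [mul_assoc] at this ⊢
  exact this
lemma e_dpow (R : Rels a b c) (X : S) (l : ℕ) : c * a * ((b * a) ^ (l + 1) * X) = a * ((b * a) ^ l * (c * b * a * X)) := by
  rw [pow_succ', ← comm_pow R.Q_d]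
  have := congrArg (· * (a * ((b * a) ^ l * X))) R.acb
  simp only [mul_assoc] at this ⊢
  exact this.symm
lemma f_epow (R : Rels a b c) (X : S) (k : ℕ) : c * b * ((c * a) ^ (k + 1) * X) = c * ((c * a) ^ k * (c * b * a * X)) := by
  rw [pow_succ', ← comm_pow R.Q_e]
  have := congrArg (· * (a * ((c * a) ^ k * X))) R.cbc
  simp only [mul_assoc] at this ⊢
  exact this
lemma Q_tail (R : Rels a b c) (k j i : ℕ) : c * b * a * ((c * a) ^ k * ((c * b) ^ j * (c * b * a) ^ i)) =
    (c * a) ^ k * ((c * b) ^ j * (c * b * a) ^ (i + 1)) := by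
  rw [comm_pow R.Q_e, comm_pow R.Q_f, pow_succ']

lemma nf_a (_ : Rels a b c) {x : S} (h : IsNF a b c x) : IsNF a b c (a * x) := by
  obtain ⟨o, n, m, l, k, j, i, h, rfl⟩ := h
  refine ⟨o + 1, n, m, l, k, j, i, h, ?_⟩
  simp only [nf, pow_succ' a, mul_assoc]

lemma nf_b (R : Rels a b c) {x : S} (h : IsNF a b c x) : IsNF a b c (b * x) := by
  obtain ⟨o, n, m, l, k, j, i, h, rfl⟩ := h
  rcases o with _ | o
  · refine ⟨0, n + 1, m, l, k, j, i, h, ?_⟩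
    simp only [nf, pow_succ' b, mul_assoc, pow_zero, one_mul]
  rcases m with _ | m
  · refine ⟨o, n, 0, l + 1, k, j, i, Or.inr rfl, ?_⟩
    simp only [nf, R.b_apow, comm_pow R.d_b, pow_zero, one_mul]
    rw [pow_succ' (b * a), mul_assoc ((b * a) : S)]
  · obtain rfl : l = 0 := by omega
    refine ⟨o, n + 1, m, 0, k + 1, j, i, Or.inl rfl, ?_⟩
    simp only [nf, R.b_apow, comm_pow R.d_b, R.d_cpow, pow_zero, one_mul, pow_mul_self]
    rw [pow_succ' (c * a), mul_assoc ((c * a) : S)]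

lemma nf_f (R : Rels a b c) (o n m l k j i : ℕ) (h : l = 0 ∨ m = 0) :
    IsNF a b c (a ^ o * (b ^ n * (c * b *
      (c ^ m * ((b * a) ^ l * ((c * a) ^ k * ((c * b) ^ j * (c * b * a) ^ i))))))) := by
  rw [comm_pow R.f_c]
  rcases l with _ | l
  · rcases k with _ | k
    · refine ⟨o, n, m, 0, 0, j + 1, i, Or.inl rfl, ?_⟩
      simp only [nf, pow_zero, one_mul]
      rw [pow_succ' (c * b), mul_assoc ((c * b) : S)]
    · refine ⟨o, n, m + 1, 0, k, j, i + 1, Or.inl rfl, ?_⟩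
      simp only [nf, pow_zero, one_mul]
      rw [R.f_epow, pow_mul_self, comm_pow R.Q_f, pow_succ' (c * b * a)]
  · obtain rfl : m = 0 := by omega
    refine ⟨o, n + 1, 0, l, k, j, i + 1, Or.inr rfl, ?_⟩
    simp only [nf, pow_zero, one_mul]
    rw [R.f_dpow, pow_mul_self, R.Q_tail]

lemma nf_c (R : Rels a b c) {x : S} (h : IsNF a b c x) : IsNF a b c (c * x) := by
  obtain ⟨o, n, m, l, k, j, i, h, rfl⟩ := h
  rcases n with _ | n
  · rcases o with _ | o
    · rcases l with _ | l
      · refine ⟨0, 0, m + 1, 0, k, j, i, Or.inl rfl, ?_⟩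
        simp only [nf, pow_zero, one_mul]
        rw [pow_succ' c, mul_assoc c (c ^ m)]
      · obtain rfl : m = 0 := by omega
        refine ⟨0, 0, 0, l, k, j, i + 1, Or.inr rfl, ?_⟩
        simp only [nf, pow_zero, one_mul]
        rw [R.c_dpow, R.Q_tail]
    · rcases l with _ | l
      · refine ⟨o, 0, m, 0, k + 1, j, i, Or.inl rfl, ?_⟩
        simp only [nf, pow_zero, one_mul]
        rw [R.c_apow, comm_pow R.e_c, pow_succ' (c * a), mul_assoc ((c * a) : S)]
      · obtain rfl : m = 0 := by omega
        refine ⟨o + 1, 0, 0, l, k, j, i + 1, Or.inr rfl, ?_⟩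
        simp only [nf, pow_zero, one_mul]
        rw [R.c_apow, R.e_dpow, pow_mul_self, R.Q_tail]
  · rcases o with _ | o
    · have := R.nf_f 0 n m l k j i h
      simp only [nf, pow_zero, one_mul] at this ⊢
      rwa [R.c_bpow]
    · have := R.nf_f (o + 1) n m l k j i h
      rw [← pow_mul_self, ← comm_pow R.f_b] at this
      simp only [nf]
      rw [R.c_apow, R.e_bpow, ← comm_pow R.f_b]
      exact this

end Rels

lemma rels_M : Rels (mk a) (mk b) (mk c) := by
  have key : ∀ u v, KnuthRel u v → mk u = mk v := fun u v h =>
    (Con.eq _).2 (ConGen.Rel.of _ _ h)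
  constructor <;> simp only [← map_mul] <;> apply key <;> constructor

lemma exists_nf (u : FreeMonoid (Fin 3)) : IsNF (mk a) (mk b) (mk c) (mk u) := by
  induction u using FreeMonoid.recOn with
  | one => exact ⟨0, 0, 0, 0, 0, 0, 0, Or.inl rfl, by simp [nf]⟩
  | of_mul x xs ih =>
    rw [map_mul]
    fin_cases x
    · exact rels_M.nf_a ih
    · exact rels_M.nf_b ih
    · exact rels_M.nf_c ih

lemma mk_nf (o n m l k j i : ℕ) :
    mk (nf a b c o n m l k j i) = nf (mk a) (mk b) (mk c) o n m l k j i := by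
  simp only [nf, map_mul, map_pow]

/-- Powers act by iterating. -/
lemma W_pow_add (u : FreeMonoid (Fin 3)) (n : ℕ) (f : ℕ → St_s11) (h : ∀ n, W u (f n) = f (n + 1)) :
    W (u ^ n) (f 0) = f n := by
  induction n with
  | zero => rw [pow_zero, W_one]
  | succ n ih => rw [pow_succ', W_mul, ih, h]


lemma W_apow (n p q z x y t : ℕ) :
    W (a ^ n) (p, q, z, x, y, t) = (p + n, q, z, x + n, y, t) :=
  W_pow_add a n (fun n => (p + n, q, z, x + n, y, t)) fun n => by
    simp only [W_a]; rfl

/-- Powers of `b` do not change the register `z`. -/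
lemma W_bpow (n : ℕ) (s : St_s11) :
    (W (b ^ n) s).2.2 = (s.2.2.1, s.2.2.2.1, s.2.2.2.2.1 + n, s.2.2.2.2.2) := by
  induction n with
  | zero => rw [pow_zero, W_one]; rfl
  | succ n ih =>
    rw [pow_succ', W_mul]
    rcases hs : W (b ^ n) s with ⟨p, q, z, x, y, t⟩
    rw [hs] at ih
    simp only [W_b, Prod.mk.injEq] at ih ⊢
    omega

lemma W_cpow (n p z x y t : ℕ) :
    W (c ^ n) (p, 0, z, x, y, t) = (p, 0, z, x, y, t + n) :=
  W_pow_add c n (fun n => (p, 0, z, x, y, t + n)) fun n => by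
    simp only [W_c]; rfl

lemma W_dpow (n p q z x y t : ℕ) :
    W ((b * a) ^ n) (p, q, z, x, y, t) = (p, q + n, z, x + n, y + n, t) :=
  W_pow_add (b * a) n (fun n => (p, q + n, z, x + n, y + n, t)) fun n => by
    simp [W_mul, W_a, W_b, add_assoc]

lemma W_epow (n p z x y t : ℕ) :
    W ((c * a) ^ n) (p, 0, z, x, y, t) = (p + n, 0, z, x + n, y, t + n) :=
  W_pow_add (c * a) n (fun n => (p + n, 0, z, x + n, y, t + n)) fun n => by
    simp [W_mul, W_a, W_c, add_assoc]

lemma W_fpow (n z x y t : ℕ) :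
    W ((c * b) ^ n) (0, 0, z, x, y, t) = (0, 0, z, x, y + n, t + n) :=
  W_pow_add (c * b) n (fun n => (0, 0, z, x, y + n, t + n)) fun n => by
    simp [W_mul, W_b, W_c, add_assoc]

lemma W_Qpow (n z x y t : ℕ) :
    W ((c * b * a) ^ n) (0, 0, z, x, y, t) = (0, 0, z + n, x + n, y + n, t + n) :=
  W_pow_add (c * b * a) n (fun n => (0, 0, z + n, x + n, y + n, t + n)) fun n => by
    simp [W_mul, W_a, W_b, W_c, add_assoc]

lemma W_nf (o n m l k j i : ℕ) (h : l = 0 ∨ m = 0) :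
    (W (nf a b c o n m l k j i) (0, 0, 0, 0, 0, 0)).2.2 =
      (i, o + l + k + i, n + l + j + i, m + k + j + i) := by
  have hcd : W (c ^ m) (0 + k, 0 + l, 0 + i, 0 + i + k + l, 0 + i + j + l, 0 + i + j + k) =
      (0 + k, 0 + l, 0 + i, 0 + i + k + l, 0 + i + j + l, 0 + i + j + k + m) := by
    rcases h with rfl | rfl
    · exact W_cpow _ _ _ _ _ _
    · rw [pow_zero, W_one]; rfl
  simp only [nf, W_mul, W_Qpow, W_fpow, W_epow, W_dpow, hcd]
  have hb := W_bpow n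
    (0 + k, 0 + l, 0 + i, 0 + i + k + l, 0 + i + j + l, 0 + i + j + k + m)
  rcases hs : W (b ^ n)
    (0 + k, 0 + l, 0 + i, 0 + i + k + l, 0 + i + j + l, 0 + i + j + k + m)
    with ⟨p, q, z, x, y, t⟩
  rw [hs] at hb
  simp only [W_apow, Prod.mk.injEq] at hb ⊢
  omega

/-- The twisted action of words on the three registers. -/
def V : FreeMonoid (Fin 3) →* Function.End St_s11 := W.comp theta

lemma V_a (p q z x y t : ℕ) :
    V a (p, q, z, x, y, t) = (p, q + 1, z, x + 1, y + 1, t) := by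
  simp [V, theta_a, W_mul, W_a, W_b]

lemma V_b (p q z x y t : ℕ) : V b (p, q, z, x, y, t) =
    (p + 1, q - 1, z + (if q = 0 then 0 else 1), x + 1, y, t + 1) := by
  simp only [V, MonoidHom.comp_apply, theta_b, W_mul, W_c, W_a]

lemma V_c (p q z x y t : ℕ) : V c (p, q, z, x, y, t) =
    (p - 1, q + (if p = 0 then 0 else 1) - 1,
      z + (if q + (if p = 0 then 0 else 1) = 0 then 0 else 1), x, y + 1, t + 1) := by
  simp only [V, MonoidHom.comp_apply, theta_c, W_mul, W_c, W_b]

lemma V_mul (u v : FreeMonoid (Fin 3)) (s : St_s11) : V (u * v) s = V u (V v s) := by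
  rw [map_mul]; rfl

lemma V_one (s : St_s11) : V 1 s = s := by
  rw [map_one]; rfl

lemma V_rel {u v : FreeMonoid (Fin 3)} (h : KnuthRel u v) : V u = V v := by
  funext ⟨p, q, z, x, y, t⟩
  cases h <;> simp only [V_mul, V_a, V_b, V_c, Prod.mk.injEq] <;> grind

/-- The twisted action factors through the plactic monoid. -/
def VM : M →* Function.End St_s11 :=
  placticCon.lift V (Con.conGen_le.2 fun _ _ h => V_rel h)

lemma VM_mk (u : FreeMonoid (Fin 3)) : VM (mk u) = V u := rfl

/-- The first two registers are tracked through powers. -/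
lemma V_pow (u : FreeMonoid (Fin 3)) (n d e p q : ℕ)
    (h : ∀ k r, ∃ r', V u (p + k * d, q + k * e, r) = (p + (k + 1) * d, q + (k + 1) * e, r'))
    (r : ℕ × ℕ × ℕ × ℕ) :
    ∃ r', V (u ^ n) (p, q, r) = (p + n * d, q + n * e, r') := by
  induction n with
  | zero => exact ⟨r, by rw [pow_zero, V_one]; simp⟩
  | succ n ih =>
    obtain ⟨r', hr⟩ := ih
    rw [pow_succ', V_mul, hr]
    exact h n r'

lemma V_nf (o n m l k j i : ℕ) (h : l = 0 ∨ m = 0) :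
    ∃ r, V (nf a b c o n m l k j i) (0, 0, 0, 0, 0, 0) = (l + n, o, r) := by
  obtain ⟨r1, h1⟩ := V_pow (c * b * a) i 0 0 0 0 (fun k ⟨z, x, y, t⟩ => by
    simp [V_mul, V_a, V_b, V_c]) (0, 0, 0, 0)
  obtain ⟨r2, h2⟩ := V_pow (c * b) j 0 0 0 0 (fun k ⟨z, x, y, t⟩ => by
    simp [V_mul, V_b, V_c]) r1
  obtain ⟨r3, h3⟩ := V_pow (c * a) k 0 0 0 0 (fun k ⟨z, x, y, t⟩ => by
    simp [V_mul, V_a, V_c]) r2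
  obtain ⟨r4, h4⟩ := V_pow (b * a) l 1 0 0 0 (fun k ⟨z, x, y, t⟩ => by
    simp [V_mul, V_a, V_b]) r3
  have h5 : ∃ r5, V (c ^ m) (l, 0, r4) = (l, 0, r5) := by
    rcases h with rfl | rfl
    · obtain ⟨r, hr⟩ := V_pow c m 0 0 0 0 (fun k ⟨z, x, y, t⟩ => by
        simp [V_c]) r4
      exact ⟨r, by simpa using hr⟩
    · exact ⟨r4, by rw [pow_zero, V_one]⟩
  obtain ⟨r5, h5⟩ := h5
  obtain ⟨r6, h6⟩ := V_pow b n 1 0 l 0 (fun k ⟨z, x, y, t⟩ => by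
    simp [V_b, add_assoc]) r5
  obtain ⟨r7, h7⟩ := V_pow a o 0 1 (l + n) 0 (fun k ⟨z, x, y, t⟩ => by
    simp [V_a]) r6
  simp only [mul_zero, mul_one, zero_add, add_zero] at h1 h2 h3 h4 h6 h7
  exact ⟨r7, by simp only [nf, V_mul, h1, h2, h3, h4, h5, h6, h7]⟩

/-- The plactic monoid embeds in `N1 × N1`. -/
lemma separates {u v : FreeMonoid (Fin 3)} (h1 : mk1 u = mk1 v)
    (h2 : mk1 (theta u) = mk1 (theta v)) : mk u = mk v := by
  have hW : W u = W v := by rw [← WN_mk1, h1, WN_mk1]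
  have hV : V u = V v := by
    change W (theta u) = W (theta v)
    rw [← WN_mk1, h2, WN_mk1]
  obtain ⟨o, n, m, l, k, j, i, h, hu⟩ := exists_nf u
  obtain ⟨o', n', m', l', k', j', i', h', hv⟩ := exists_nf v
  rw [← mk_nf] at hu hv
  rw [← WM_mk, ← WM_mk, hu, hv, WM_mk, WM_mk] at hW
  rw [← VM_mk, ← VM_mk, hu, hv, VM_mk, VM_mk] at hV
  have e1 := W_nf o n m l k j i h
  obtain ⟨r, e2⟩ := V_nf o n m l k j i h
  obtain ⟨r', e2'⟩ := V_nf o' n' m' l' k' j' i' h'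
  rw [hW, W_nf o' n' m' l' k' j' i' h'] at e1
  rw [hV, e2'] at e2
  simp only [Prod.mk.injEq] at e1 e2
  obtain ⟨rfl, rfl, rfl, rfl, rfl, rfl, rfl⟩ :
      o = o' ∧ n = n' ∧ m = m' ∧ l = l' ∧ k = k' ∧ j = j' ∧ i = i' := by omega
  rw [hu, hv]

lemma lift_hom {S T X : Type*} [Monoid S] [Monoid T] (π : S →* T) (hπ : Function.Surjective π)
    (φ : FreeMonoid X →* T) : ∃ ψ : FreeMonoid X →* S, ∀ w, π (ψ w) = φ w := by
  choose r hr using hπ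
  refine ⟨FreeMonoid.lift fun x => r (φ (FreeMonoid.of x)), fun w => ?_⟩
  rw [← MonoidHom.comp_apply]
  congr 1
  ext x
  simp [hr]


/-- The plactic monoid `M` and the monoid `N1` are equationally equivalent. -/
theorem M_equationally_equivalent_N1 :
    ∀ (X : Type*) (w w' : FreeMonoid X),
      SatisfiesId M w w' ↔ SatisfiesId N1 w w' := by
  intro X w w'
  constructor
  · intro h φ
    obtain ⟨ψ, hψ⟩ := lift_hom con1.mk' Con.mk'_surjective φ
    rw [← hψ, ← hψ, h ψ]
  · intro h φ
    obtain ⟨ψ, hψ⟩ := lift_hom mk Con.mk'_surjective φ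
    rw [← hψ, ← hψ]
    exact separates (h (mk1.comp ψ)) (h ((mk1.comp theta).comp ψ))

end Plactic
end

section
/- The monoid N1 and its quotient N1' := N1/(cba = 1) (the quotient of N1 by the congruence generated by the pair (z, 1), where z is the image in N1 of the word cba) are equationally equivalent: for every type X and all words w, w' ∈ FreeMonoid X, N1 satisfies the identity w ≍ w' if and only if N1' satisfies the identity w ≍ w'. -/
namespace Plactic

/-- The congruence on `N1` generated by the pair `(z, 1)`, where `z` is the
image of `cba` in `N1`. -/
def conN1' : Con N1 := conGen (fun x y => x = con1.mk' (mk (c * b * a)) ∧ y = 1)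

/-- `N1' = N1/(cba = 1)`. -/
abbrev N1' := conN1'.Quotient

/-- Normal forms `a^p b^n (ba)^j c^k (cb)^l` modulo `cba`. -/
@[ext] structure NF where
  p : ℕ
  n : ℕ
  j : ℕ
  k : ℕ
  l : ℕ

/-- Left multiplication by `a`. -/
def actA (s : NF) : NF := ⟨s.p + 1, s.n, s.j, s.k, s.l⟩

/-- Left multiplication by `b`. -/
def actB : NF → NF
  | ⟨0, n, j, k, l⟩ => ⟨0, n + 1, j, k, l⟩
  | ⟨p + 1, n, j, k, l⟩ => ⟨p, n, j + 1, k, l⟩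

/-- Left multiplication by `c`. -/
def actC : NF → NF
  | ⟨p, n, j + 1, k, l⟩ => ⟨p, n, j, k, l⟩
  | ⟨p, n + 1, 0, k, l⟩ => ⟨p, n, 0, k, l + 1⟩
  | ⟨p, 0, 0, k, l⟩ => ⟨p, 0, 0, k + 1, l⟩

/-- The action of a generator. -/
def actG : Fin 3 → Function.End NF := ![actA, actB, actC]

/-- The action of words on normal forms. -/
def actF : FreeMonoid (Fin 3) →* Function.End NF := FreeMonoid.lift actG

theorem actF_a : actF a = actA := FreeMonoid.lift_eval_of _ _
theorem actF_b : actF b = actB := FreeMonoid.lift_eval_of _ _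
theorem actF_c : actF c = actC := FreeMonoid.lift_eval_of _ _

/-- The number of letters `a`. -/
def cntF : FreeMonoid (Fin 3) →* Multiplicative ℕ :=
  FreeMonoid.lift ![Multiplicative.ofAdd 1, 1, 1]

theorem cntF_a : cntF a = Multiplicative.ofAdd 1 := FreeMonoid.lift_eval_of _ _
theorem cntF_b : cntF b = 1 := FreeMonoid.lift_eval_of _ _
theorem cntF_c : cntF c = 1 := FreeMonoid.lift_eval_of _ _

theorem actAC (s : NF) : actA (actC s) = actC (actA s) := by
  obtain ⟨p, n, j, k, l⟩ := s
  rcases j with _ | j <;> rcases n with _ | n <;> rfl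

theorem act_cba (s : NF) : actC (actB (actA s)) = s := rfl

theorem act_aba (s : NF) : actA (actB (actA s)) = actB (actA (actA s)) := rfl

theorem act_bab (s : NF) : actB (actA (actB s)) = actB (actB (actA s)) := by
  obtain ⟨p, n, j, k, l⟩ := s
  rcases p with _ | p <;> rfl

theorem act_cbb (s : NF) : actC (actB (actB s)) = actB (actC (actB s)) := by
  obtain ⟨p, n, j, k, l⟩ := s
  rcases p with _ | _ | p <;> rcases j with _ | j <;> rfl

theorem act_cbc (s : NF) : actC (actB (actC s)) = actC (actC (actB s)) := by
  obtain ⟨p, n, j, k, l⟩ := s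
  rcases p with _ | p <;> rcases j with _ | _ | j <;> rcases n with _ | n <;> rfl

theorem knuth_actF {u v : FreeMonoid (Fin 3)} (h : KnuthRel u v) : actF u = actF v := by
  funext s
  cases h <;> simp only [map_mul, actF_a, actF_b, actF_c]
  · exact act_aba s
  · exact act_bab s
  · exact actAC (actA s)
  · exact congrArg actC (actAC s)
  · exact act_cbb s
  · exact act_cbc s
  · exact congrArg actB (actAC s)
  · exact actAC (actB s)

theorem knuth_cntF {u v : FreeMonoid (Fin 3)} (h : KnuthRel u v) : cntF u = cntF v := by
  cases h <;> simp [map_mul, cntF_a, cntF_b, cntF_c]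

/-- The action of `M`. -/
def actM : M →* Function.End NF :=
  placticCon.lift actF (Con.conGen_le.2 fun _ _ h => knuth_actF h)

theorem actM_mk (u : FreeMonoid (Fin 3)) : actM (mk u) = actF u := rfl

/-- The count on `M`. -/
def cntM : M →* Multiplicative ℕ :=
  placticCon.lift cntF (Con.conGen_le.2 fun _ _ h => knuth_cntF h)

theorem cntM_mk (u : FreeMonoid (Fin 3)) : cntM (mk u) = cntF u := rfl

theorem actM_ac {x y : M} (h : x = mk (a * c) ∧ y = mk (c * a)) : actM x = actM y := by
  rw [h.1, h.2, actM_mk, actM_mk, map_mul, map_mul, actF_a, actF_c]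
  funext s
  exact actAC s

theorem cntM_ac {x y : M} (h : x = mk (a * c) ∧ y = mk (c * a)) : cntM x = cntM y := by
  rw [h.1, h.2, cntM_mk, cntM_mk, map_mul, map_mul, mul_comm]

/-- The action of `N1`. -/
def actN : N1 →* Function.End NF :=
  con1.lift actM (Con.conGen_le.2 fun _ _ h => actM_ac h)

/-- The count on `N1`. -/
def cntN : N1 →* Multiplicative ℕ :=
  con1.lift cntM (Con.conGen_le.2 fun _ _ h => cntM_ac h)

/-- The projection to `N1`. -/
def toN : FreeMonoid (Fin 3) →* N1 := con1.mk'.comp mk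

theorem actN_toN (u : FreeMonoid (Fin 3)) : actN (toN u) = actF u := rfl
theorem cntN_toN (u : FreeMonoid (Fin 3)) : cntN (toN u) = cntF u := rfl

theorem actN_z {x y : N1} (h : x = con1.mk' (mk (c * b * a)) ∧ y = 1) : actN x = actN y := by
  rw [h.1, h.2, map_one]
  change actN (toN (c * b * a)) = 1
  rw [actN_toN, map_mul, map_mul, actF_a, actF_b, actF_c]
  funext s
  exact act_cba s

/-- The action of `N1'`. -/
def actN' : N1' →* Function.End NF :=
  conN1'.lift actN (Con.conGen_le.2 fun _ _ h => actN_z h)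

theorem actN'_mk (u : N1) : actN' (conN1'.mk' u) = actN u := rfl

/-- Evaluation of a normal form in a monoid. -/
def ev {S : Type*} [Monoid S] (A B C : S) (s : NF) : S :=
  A ^ s.p * (B ^ s.n * ((B * A) ^ s.j * (C ^ s.k * (C * B) ^ s.l)))

section
variable {S : Type*} [Monoid S] {A B C : S}

theorem ev_a (s : NF) : A * ev A B C s = ev A B C (actA s) := by
  simp only [ev, actA, pow_succ', mul_assoc]

theorem ev_b (hA : Commute (B * A) A) (hB : Commute (B * A) B) (s : NF) :
    B * ev A B C s = ev A B C (actB s) := by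
  obtain ⟨p, n, j, k, l⟩ := s
  rcases p with _ | p
  · simp only [ev, actB, pow_succ', mul_assoc, pow_zero, one_mul]
  · simp only [ev, actB]
    rw [pow_succ' A, pow_succ' (B * A), ← mul_assoc B, ← mul_assoc B,
      (hA.pow_right p).eq, mul_assoc, ← mul_assoc (B * A) (B ^ n), (hB.pow_right n).eq]
    simp only [mul_assoc]

/-- The exponent of `cba` that appears. -/
def exC (s : NF) : ℕ := if s.j = 0 then 0 else 1

theorem ev_c (hAC : Commute A C) (hA : Commute (B * A) A) (hB : Commute (B * A) B)
    (hB' : Commute (C * B) B) (hC' : Commute (C * B) C) (s : NF) :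
    C * ev A B C s = (C * B * A) ^ exC s * ev A B C (actC s) := by
  obtain ⟨p, n, j, k, l⟩ := s
  rcases j with _ | j
  · rcases n with _ | n
    · simp only [ev, actC, exC, pow_zero, one_mul, if_true]
      rw [← mul_assoc, ← (hAC.pow_left p).eq, pow_succ']
      simp only [mul_assoc]
    · simp only [ev, actC, exC, pow_zero, one_mul, if_true]
      rw [← mul_assoc, ← (hAC.pow_left p).eq, pow_succ' B, pow_succ' (C * B) l, mul_assoc,
        ← mul_assoc C, ← mul_assoc C, (hB'.pow_right n).eq, ← mul_assoc (C ^ k),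
        ← (hC'.pow_right k).eq]
      simp only [mul_assoc]
  · have hz : Commute (C * B * A) A := by
      rw [mul_assoc]; exact hAC.symm.mul_left hA
    simp only [ev, actC, exC, Nat.add_eq_zero_iff, one_ne_zero, and_false, if_false, pow_one]
    rw [← mul_assoc, ← (hAC.pow_left p).eq, pow_succ' (B * A), ← mul_assoc (C * B * A),
      (hz.pow_right p).eq, mul_assoc, mul_assoc (A ^ p), mul_assoc (B * A),
      ← mul_assoc (B ^ n) (B * A), ← (hB.pow_right n).eq]
    simp only [mul_assoc]

end

theorem toN_knuth {u v : FreeMonoid (Fin 3)} (h : KnuthRel u v) : toN u = toN v :=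
  congrArg con1.mk' ((Con.eq placticCon).2 (ConGen.Rel.of _ _ h))

theorem toN_ac : Commute (toN a) (toN c) := by
  have : toN (a * c) = toN (c * a) := (Con.eq con1).2 (ConGen.Rel.of _ _ ⟨rfl, rfl⟩)
  simp only [map_mul] at this
  exact this

theorem hA : Commute (toN b * toN a) (toN a) := by
  have := toN_knuth .aba
  simp only [map_mul] at this
  exact this.symm.trans (mul_assoc _ _ _)

theorem hB : Commute (toN b * toN a) (toN b) := by
  have := toN_knuth .bab
  simp only [map_mul] at this
  exact this.trans (mul_assoc _ _ _)

theorem hB' : Commute (toN c * toN b) (toN b) := by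
  have := toN_knuth .cbb
  simp only [map_mul] at this
  exact this.trans (mul_assoc _ _ _)

theorem hC' : Commute (toN c * toN b) (toN c) := by
  have := toN_knuth .cbc
  simp only [map_mul] at this
  exact this.trans (mul_assoc _ _ _)

/-- The image of `cba`. -/
def zz : N1 := toN c * toN b * toN a

theorem zz_a : Commute zz (toN a) := by
  unfold zz; rw [mul_assoc]; exact toN_ac.symm.mul_left hA

theorem zz_c : Commute zz (toN c) := hC'.mul_left toN_ac

theorem zz_b : Commute zz (toN b) := by
  change _ * _ = _ * _
  unfold zz
  rw [mul_assoc (toN c), mul_assoc (toN c), hB.eq, ← mul_assoc, ← mul_assoc, hB'.eq]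
  simp only [mul_assoc]

/-- The empty normal form. -/
def s0 : NF := ⟨0, 0, 0, 0, 0⟩

/-- Evaluation in `N1`. -/
def evN (s : NF) : N1 := ev (toN a) (toN b) (toN c) s

theorem act_weight_b (s : NF) : (actB s).p + (actB s).j = s.p + s.j := by
  obtain ⟨p, n, j, k, l⟩ := s
  rcases p with _ | p <;> simp only [actB] <;> omega

theorem act_weight_c (s : NF) : exC s + ((actC s).p + (actC s).j) = s.p + s.j := by
  obtain ⟨p, n, j, k, l⟩ := s
  rcases j with _ | j <;> rcases n with _ | n <;> simp [actC, exC] <;> omega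

theorem toN_normal (u : FreeMonoid (Fin 3)) : ∃ i : ℕ,
    toN u = zz ^ i * evN (actF u s0) ∧
    Multiplicative.toAdd (cntF u) = i + ((actF u s0).p + (actF u s0).j) := by
  induction u using FreeMonoid.inductionOn' with
  | one =>
    refine ⟨0, ?_, rfl⟩
    change 1 = zz ^ 0 * evN s0
    simp [evN, ev, s0]
  | of_mul g u ih =>
    obtain ⟨i, h1, h2⟩ := ih
    have key : ∀ (x : FreeMonoid (Fin 3)), Commute zz (toN x) → ∀ e : ℕ,
        toN x * evN (actF u s0) = zz ^ e * evN (actF x (actF u s0)) →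
        Multiplicative.toAdd (cntF x) + ((actF u s0).p + (actF u s0).j) =
          e + ((actF x (actF u s0)).p + (actF x (actF u s0)).j) →
        ∃ i : ℕ, toN (x * u) = zz ^ i * evN (actF (x * u) s0) ∧
          Multiplicative.toAdd (cntF (x * u)) =
            i + ((actF (x * u) s0).p + (actF (x * u) s0).j) := by
      intro x hx e e1 e2
      refine ⟨i + e, ?_, ?_⟩
      · rw [map_mul, h1, ← mul_assoc, ← (hx.pow_left i).eq, mul_assoc, e1, pow_add, mul_assoc,
          map_mul]
        rfl
      · rw [map_mul cntF, toAdd_mul, h2]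
        have hh : actF (x * u) s0 = actF x (actF u s0) := congrFun (map_mul actF x u) s0
        rw [hh]
        omega
    fin_cases g
    · refine key a zz_a 0 ?_ ?_
      · rw [actF_a, pow_zero, one_mul]; exact ev_a _
      · rw [actF_a, cntF_a, toAdd_ofAdd]; simp only [actA]; omega
    · refine key b zz_b 0 ?_ ?_
      · rw [actF_b, pow_zero, one_mul]; exact ev_b hA hB _
      · rw [actF_b, cntF_b, toAdd_one, act_weight_b]
    · refine key c zz_c (exC (actF u s0)) ?_ ?_
      · rw [actF_c]; exact ev_c toN_ac hA hB hB' hC' _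
      · rw [actF_c, cntF_c, toAdd_one, act_weight_c]; omega

theorem toN_surj : Function.Surjective toN :=
  (Con.mk'_surjective (c := con1)).comp (Con.mk'_surjective (c := placticCon))

/-- `N1` embeds in the product of `N1'` and the natural numbers. -/
theorem N1_ext {x y : N1} (h : conN1'.mk' x = conN1'.mk' y) (hc : cntN x = cntN y) : x = y := by
  have ha : actN x = actN y := by rw [← actN'_mk, h, actN'_mk]
  obtain ⟨u, rfl⟩ := toN_surj x
  obtain ⟨v, rfl⟩ := toN_surj y
  rw [actN_toN, actN_toN] at ha
  rw [cntN_toN, cntN_toN] at hc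
  obtain ⟨i, h1, h2⟩ := toN_normal u
  obtain ⟨i', h1', h2'⟩ := toN_normal v
  rw [ha] at h1 h2
  rw [hc, h2'] at h2
  have : i = i' := by omega
  rw [h1, h1', this]

theorem actA_pow (m : ℕ) : (((show Function.End NF from actA) ^ m) s0).p = m := by
  induction m with
  | zero => rfl
  | succ m ih =>
    rw [pow_succ']
    exact congrArg (· + 1) ih

/-- Powers of the image of `a` in `N1'`. -/
def powA : Multiplicative ℕ →* N1' := powersHom N1' (conN1'.mk' (toN a))

theorem powA_inj : Function.Injective powA := by
  intro m m' h
  have key : ∀ m : Multiplicative ℕ, (actN' (powA m) s0).p = Multiplicative.toAdd m := by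
    intro m
    have : actN' (powA m) = (show Function.End NF from actA) ^ (Multiplicative.toAdd m) := by
      rw [powA, powersHom_apply, map_pow, actN'_mk, actN_toN, actF_a]
    rw [this, actA_pow]
  have := key m
  rw [h, key m'] at this
  exact Multiplicative.toAdd.injective this.symm

/-- The monoid `N1` and its quotient `N1' = N1/(cba = 1)` are equationally
equivalent. -/
theorem N1_equationally_equivalent_N1' :
    ∀ (X : Type*) (w w' : FreeMonoid X),
      SatisfiesId N1 w w' ↔ SatisfiesId N1' w w' := by
  intro X w w'
  constructor
  · intro h φ
    choose f hf using fun x : X => Con.mk'_surjective (c := conN1') (φ (FreeMonoid.of x))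
    have : φ = conN1'.mk'.comp (FreeMonoid.lift f) := by
      apply FreeMonoid.hom_eq
      intro x
      rw [MonoidHom.comp_apply, FreeMonoid.lift_eval_of, hf]
    rw [this, MonoidHom.comp_apply, MonoidHom.comp_apply, h]
  · intro h φ
    refine N1_ext (h (conN1'.mk'.comp φ)) ?_
    exact powA_inj (h (powA.comp (cntN.comp φ)))

end Plactic
end
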